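/- arXiv:1809.10987 — 6 statements merged into one kernel-verified Lean document; each statement's English description precedes it below -/
import Mathlib

section
/- Let Λ be a lattice in ℝ^n, let Q be a positive definite symmetric bilinear form on ℝ^n that is integral with respect to Λ, fix r ∈ ℝ^n, and let B ⊂ ℤ^n be a complete set of representatives of ℤ^n/q(Λ). Let S = {(φ^b(Θ))_{b∈B} ∈ ℝ^B : Θ a theta function for (Q, Q(·,r))}, where φ^b(Θ) = inf_{y∈ℝ^n}(Θ(y) − Θ_b(y)). Then S contains the origin of ℝ^B, and there exists ε > 0 such that ε·e_b ∈ S for every b ∈ B (e_b the standard basis vector); consequently S has nonempty interior in ℝ^B, i.e. S is a |B|-dimensional convex set. -/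
noncomputable section

/-- Standard inner product on ℝ^n. -/
def dotp {n : ℕ} (a x : Fin n → ℝ) : ℝ := ∑ i, a i * x i

/-- Λ is a (full-rank) lattice in ℝ^n. -/
def IsLattice {n : ℕ} (Λ : Set (Fin n → ℝ)) : Prop :=
  ∃ e : Module.Basis (Fin n) ℝ (Fin n → ℝ),
    Λ = {x | ∃ c : Fin n → ℤ, x = ∑ i, (c i : ℝ) • e i}

/-- Q is a symmetric bilinear form. -/
def IsSymmBilin {n : ℕ} (Q : (Fin n → ℝ) → (Fin n → ℝ) → ℝ) : Prop :=
  (∀ x, IsLinearMap ℝ (Q x)) ∧ ∀ x y, Q x y = Q y x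

/-- Quasi-periodicity condition for (Q, α). -/
def QuasiPeriodic {n : ℕ} (Λ : Set (Fin n → ℝ))
    (Q : (Fin n → ℝ) → (Fin n → ℝ) → ℝ) (α : (Fin n → ℝ) → ℝ)
    (Θ : (Fin n → ℝ) → ℝ) : Prop :=
  ∀ l ∈ Λ, ∀ x, Θ (x + l) = Θ x + Q l x + (1/2) * Q l l + α l

/-- Θ is regular: locally a max of finitely many affine functions with integral slopes. -/
def RegularFn {n : ℕ} (Θ : (Fin n → ℝ) → ℝ) : Prop :=
  ∀ x : Fin n → ℝ, ∃ U ∈ nhds x, ∃ (k : ℕ) (a : Fin (k+1) → Fin n → ℤ) (c : Fin (k+1) → ℝ),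
    ∀ y ∈ U, Θ y = Finset.univ.sup' Finset.univ_nonempty
      (fun i => dotp (fun j => (a i j : ℝ)) y + c i)

/-- A theta function for (Q, α): convex, regular, quasi-periodic. -/
def IsThetaFn {n : ℕ} (Λ : Set (Fin n → ℝ))
    (Q : (Fin n → ℝ) → (Fin n → ℝ) → ℝ) (α : (Fin n → ℝ) → ℝ)
    (Θ : (Fin n → ℝ) → ℝ) : Prop :=
  ConvexOn ℝ Set.univ Θ ∧ RegularFn Θ ∧ QuasiPeriodic Λ Q α Θ

/-- Q is integral with respect to Λ. -/
def IntegralWrt {n : ℕ} (Q : (Fin n → ℝ) → (Fin n → ℝ) → ℝ) (Λ : Set (Fin n → ℝ)) : Prop :=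
  ∀ l ∈ Λ, ∀ m : Fin n → ℤ, ∃ k : ℤ, Q l (fun i => (m i : ℝ)) = (k : ℝ)

/-- m lies in q(Λ): ⟨m,x⟩ = Q(λ,x) for some λ ∈ Λ and all x. -/
def InQLat {n : ℕ} (Λ : Set (Fin n → ℝ)) (Q : (Fin n → ℝ) → (Fin n → ℝ) → ℝ)
    (m : Fin n → ℝ) : Prop :=
  ∃ l ∈ Λ, ∀ x, dotp m x = Q l x

/-- The generator Θ_b (with v_b passed as `vb`). -/
def ThetaGen {n : ℕ} (Λ : Set (Fin n → ℝ)) (Q : (Fin n → ℝ) → (Fin n → ℝ) → ℝ)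
    (r vb : Fin n → ℝ) (b : Fin n → ℤ) (x : Fin n → ℝ) : ℝ :=
  sSup {t | ∃ l ∈ Λ, t = dotp (fun i => (b i : ℝ)) x + Q l x
      - (1/2) * Q (l + vb - r) (l + vb - r)}

/-- The Legendre transform of Θ. -/
def legendreT {n : ℕ} (Θ : (Fin n → ℝ) → ℝ) (a : Fin n → ℝ) : ℝ :=
  sSup {t | ∃ x, t = dotp a x - Θ x}

/-- The generator Θ_b, with v_b obtained from the duality map v. -/
def thetaGenOf {n : ℕ} (Λ : Set (Fin n → ℝ)) (Q : (Fin n → ℝ) → (Fin n → ℝ) → ℝ)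
    (r : Fin n → ℝ) (v : (Fin n → ℝ) → (Fin n → ℝ)) (b : Fin n → ℤ) :
    (Fin n → ℝ) → ℝ :=
  ThetaGen Λ Q r (v (fun i => (b i : ℝ))) b

/-- φ^b(Θ) = inf_y (Θ(y) − Θ_b(y)). -/
def phiB {n : ℕ} (Λ : Set (Fin n → ℝ)) (Q : (Fin n → ℝ) → (Fin n → ℝ) → ℝ)
    (r : Fin n → ℝ) (v : (Fin n → ℝ) → (Fin n → ℝ)) (b : Fin n → ℤ)
    (Θ : (Fin n → ℝ) → ℝ) : ℝ :=
  sInf {u | ∃ y, u = Θ y - thetaGenOf Λ Q r v b y}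

/-- The coordinate set S ⊂ ℝ^B of tuples (φ^b(Θ))_{b∈B} for theta functions Θ. -/
def thetaCoordSet {n : ℕ} (Λ : Set (Fin n → ℝ)) (Q : (Fin n → ℝ) → (Fin n → ℝ) → ℝ)
    (r : Fin n → ℝ) (v : (Fin n → ℝ) → (Fin n → ℝ)) (B : Finset (Fin n → ℤ)) :
    Set ({b // b ∈ B} → ℝ) :=
  {t | ∃ Θ, IsThetaFn Λ Q (fun x => Q x r) Θ ∧
      ∀ b : {b // b ∈ B}, t b = phiB Λ Q r v b.1 Θ}

/-- Ξ(x) = sup over a ∈ ℤ^n of (⟨a,x⟩ − ½ Q(v_a−r, v_a−r)). -/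
def XiFn {n : ℕ} (Q : (Fin n → ℝ) → (Fin n → ℝ) → ℝ) (v : (Fin n → ℝ) → (Fin n → ℝ))
    (r : Fin n → ℝ) (x : Fin n → ℝ) : ℝ :=
  sSup {t | ∃ a : Fin n → ℤ, t = dotp (fun i => (a i : ℝ)) x
      - (1/2) * Q (v (fun i => (a i : ℝ)) - r) (v (fun i => (a i : ℝ)) - r)}



section helpers

variable {n : ℕ} {Q : (Fin n → ℝ) → (Fin n → ℝ) → ℝ}

/-- cast of an integer vector -/
def zc {n : ℕ} (a : Fin n → ℤ) : Fin n → ℝ := fun i => (a i : ℝ)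

lemma Qaddr (hQ : IsSymmBilin Q) (x y z : Fin n → ℝ) : Q x (y + z) = Q x y + Q x z :=
  (hQ.1 x).map_add y z
lemma Qsmulr (hQ : IsSymmBilin Q) (t : ℝ) (x y : Fin n → ℝ) : Q x (t • y) = t * Q x y :=
  (hQ.1 x).map_smul t y
lemma Qaddl (hQ : IsSymmBilin Q) (x y z : Fin n → ℝ) : Q (x + y) z = Q x z + Q y z := by
  rw [hQ.2, Qaddr hQ, hQ.2 z x, hQ.2 z y]
lemma Qsmull (hQ : IsSymmBilin Q) (t : ℝ) (x y : Fin n → ℝ) : Q (t • x) y = t * Q x y := by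
  rw [hQ.2, Qsmulr hQ, hQ.2]
lemma Qnegr (hQ : IsSymmBilin Q) (x y : Fin n → ℝ) : Q x (-y) = - Q x y := by
  rw [← neg_one_smul ℝ y, Qsmulr hQ]; ring
lemma Qnegl (hQ : IsSymmBilin Q) (x y : Fin n → ℝ) : Q (-x) y = - Q x y := by
  rw [hQ.2, Qnegr hQ, hQ.2]
lemma Qsubr (hQ : IsSymmBilin Q) (x y z : Fin n → ℝ) : Q x (y - z) = Q x y - Q x z := by
  rw [sub_eq_add_neg, Qaddr hQ, Qnegr hQ]; ring
lemma Qsubl (hQ : IsSymmBilin Q) (x y z : Fin n → ℝ) : Q (x - y) z = Q x z - Q y z := by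
  rw [sub_eq_add_neg, Qaddl hQ, Qnegl hQ]; ring

lemma Qnn (hQ : IsSymmBilin Q) (hpos : ∀ x : Fin n → ℝ, x ≠ 0 → 0 < Q x x) (x : Fin n → ℝ) :
    0 ≤ Q x x := by
  by_cases h : x = 0
  · subst h
    have := Qsmulr hQ 0 0 (0 : Fin n → ℝ)
    simp at this
    exact this.ge
  · exact (hpos x h).le

lemma Qcs (hQ : IsSymmBilin Q) (hpos : ∀ x : Fin n → ℝ, x ≠ 0 → 0 < Q x x) (x y : Fin n → ℝ) :
    (Q x y) ^ 2 ≤ Q x x * Q y y := by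
  have h : ∀ t : ℝ, 0 ≤ Q y y * (t * t) + (2 * Q x y) * t + Q x x := by
    intro t
    have := Qnn hQ hpos (x + t • y)
    rw [Qaddl hQ, Qaddr hQ, Qaddr hQ, Qsmull hQ, Qsmull hQ, Qsmulr hQ, Qsmulr hQ, hQ.2 y x] at this
    linarith
  have := discrim_le_zero h
  unfold discrim at this
  nlinarith

lemma Qinj (hQ : IsSymmBilin Q) (hpos : ∀ x : Fin n → ℝ, x ≠ 0 → 0 < Q x x) {u w : Fin n → ℝ}
    (h : ∀ x, Q u x = Q w x) : u = w := by
  by_contra hne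
  have := hpos (u - w) (sub_ne_zero.2 hne)
  rw [Qsubl hQ, h] at this
  linarith

lemma Qcont (hQ : IsSymmBilin Q) : Continuous fun x : Fin n → ℝ => Q x x := by
  have h2 : ∀ x y, Q x y = ∑ i, x i * Q (Pi.single i 1) y := by
    intro x y
    have e : x = ∑ i, x i • (Pi.single i (1:ℝ) : Fin n → ℝ) := pi_eq_sum_univ' x
    have : Q y x = ∑ i, x i * Q y (Pi.single i 1) := by
      have := map_sum (IsLinearMap.mk' _ (hQ.1 y))
        (fun i => x i • (Pi.single i (1:ℝ) : Fin n → ℝ)) Finset.univ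
      rw [← e] at this
      simpa [Qsmulr hQ] using this
    rw [hQ.2, this]
    simp [hQ.2 y]
  have : (fun x : Fin n → ℝ => Q x x) = fun x => ∑ i, x i * Q (Pi.single i 1) x := by
    funext x; exact h2 x x
  rw [this]
  refine continuous_finsetSum _ fun i _ => (continuous_apply i).mul ?_
  exact (IsLinearMap.mk' _ (hQ.1 (Pi.single i 1))).continuous_of_finiteDimensional

lemma dotp_single (a : Fin n → ℝ) (i : Fin n) : dotp a (Pi.single i 1) = a i := by
  simp [dotp, Pi.single_apply]

/-- Affine pieces. -/
def pc {n : ℕ} (Q : (Fin n → ℝ) → (Fin n → ℝ) → ℝ) (r : Fin n → ℝ)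
    (v : (Fin n → ℝ) → (Fin n → ℝ)) (c : (Fin n → ℤ) → ℝ) (a : Fin n → ℤ) (x : Fin n → ℝ) : ℝ :=
  dotp (zc a) x - (1/2) * Q (v (zc a) - r) (v (zc a) - r) + c a

/-- The quadratic function P. -/
def Pq {n : ℕ} (Q : (Fin n → ℝ) → (Fin n → ℝ) → ℝ) (r : Fin n → ℝ) (x : Fin n → ℝ) : ℝ :=
  (1/2) * Q x x + Q x r

/-- The candidate theta function. -/
def Th {n : ℕ} (Q : (Fin n → ℝ) → (Fin n → ℝ) → ℝ) (r : Fin n → ℝ)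
    (v : (Fin n → ℝ) → (Fin n → ℝ)) (c : (Fin n → ℤ) → ℝ) (x : Fin n → ℝ) : ℝ :=
  ⨆ a : Fin n → ℤ, pc Q r v c a x

variable {r : Fin n → ℝ} {v : (Fin n → ℝ) → (Fin n → ℝ)} {c : (Fin n → ℤ) → ℝ} {S : ℝ}

lemma complete_sq (hQ : IsSymmBilin Q) (w x r : Fin n → ℝ) :
    Q w x - (1/2) * Q (w - r) (w - r) = Pq Q r x - (1/2) * Q (w - r - x) (w - r - x) := by
  unfold Pq
  simp only [Qsubl hQ, Qsubr hQ]
  rw [hQ.2 r w, hQ.2 x w, hQ.2 x r]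
  ring

lemma pc_eq (hQ : IsSymmBilin Q) (hv : ∀ a x, Q (v a) x = dotp a x) (a : Fin n → ℤ)
    (x : Fin n → ℝ) : pc Q r v c a x =
      Pq Q r x - (1/2) * Q (v (zc a) - r - x) (v (zc a) - r - x) + c a := by
  unfold pc
  rw [← hv, complete_sq hQ]

lemma pc_le (hQ : IsSymmBilin Q) (hpos : ∀ x : Fin n → ℝ, x ≠ 0 → 0 < Q x x)
    (hv : ∀ a x, Q (v a) x = dotp a x) (hc : ∀ a, |c a| ≤ S) (a : Fin n → ℤ)
    (x : Fin n → ℝ) : pc Q r v c a x ≤ Pq Q r x + S := by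
  rw [pc_eq hQ hv]
  have := Qnn hQ hpos (v (zc a) - r - x)
  have := (abs_le.1 (hc a)).2
  linarith

lemma pc_bdd (hQ : IsSymmBilin Q) (hpos : ∀ x : Fin n → ℝ, x ≠ 0 → 0 < Q x x)
    (hv : ∀ a x, Q (v a) x = dotp a x) (hc : ∀ a, |c a| ≤ S)
    (x : Fin n → ℝ) : BddAbove (Set.range fun a => pc Q r v c a x) :=
  ⟨Pq Q r x + S, by rintro _ ⟨a, rfl⟩; exact pc_le hQ hpos hv hc a x⟩

lemma Th_convex (hQ : IsSymmBilin Q) (hpos : ∀ x : Fin n → ℝ, x ≠ 0 → 0 < Q x x)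
    (hv : ∀ a x, Q (v a) x = dotp a x) (hc : ∀ a, |c a| ≤ S) :
    ConvexOn ℝ Set.univ (Th Q r v c) := by
  refine ⟨convex_univ, fun x _ y _ s t hs ht hst => ?_⟩
  refine ciSup_le fun a => ?_
  have h1 : pc Q r v c a x ≤ Th Q r v c x := le_ciSup (pc_bdd hQ hpos hv hc x) a
  have h2 : pc Q r v c a y ≤ Th Q r v c y := le_ciSup (pc_bdd hQ hpos hv hc y) a
  have e : pc Q r v c a (s • x + t • y) = s * pc Q r v c a x + t * pc Q r v c a y := by
    unfold pc
    rw [← hv, ← hv, ← hv, Qaddr hQ, Qsmulr hQ, Qsmulr hQ]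
    have : t = 1 - s := by linarith
    subst this
    ring
  rw [e]
  simp only [smul_eq_mul]
  gcongr

lemma Q_le_two (hQ : IsSymmBilin Q) (hpos : ∀ x : Fin n → ℝ, x ≠ 0 → 0 < Q x x)
    (x y : Fin n → ℝ) : Q (x + y) (x + y) ≤ 2 * Q x x + 2 * Q y y := by
  have := Qnn hQ hpos (x - y)
  simp only [Qsubl hQ, Qsubr hQ, Qaddl hQ, Qaddr hQ] at *
  linarith

lemma fin_small (hQ : IsSymmBilin Q) (hpos : ∀ x : Fin n → ℝ, x ≠ 0 → 0 < Q x x)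
    (hv : ∀ a x, Q (v a) x = dotp a x) (M : ℝ) :
    {a : Fin n → ℤ | Q (v (zc a)) (v (zc a)) ≤ M}.Finite := by
  have key : ∀ i : Fin n, ∃ N : ℤ, ∀ a : Fin n → ℤ, Q (v (zc a)) (v (zc a)) ≤ M → |a i| ≤ N := by
    intro i
    obtain ⟨N, hN⟩ := exists_int_gt (M * Q (Pi.single i 1) (Pi.single i 1) + 1)
    refine ⟨N, fun a ha => ?_⟩
    have h1 := Qcs hQ hpos (v (zc a)) (Pi.single i 1)
    rw [hv, dotp_single] at h1
    have h2 : Q (v (zc a)) (v (zc a)) * Q (Pi.single i 1) (Pi.single i 1) ≤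
      M * Q (Pi.single i 1) (Pi.single i 1) :=
      mul_le_mul_of_nonneg_right ha (Qnn hQ hpos _)
    have h3 : ((a i : ℝ))^2 ≤ N := by
      have : zc a i = (a i : ℝ) := rfl
      rw [this] at h1
      linarith
    have h4 : (a i)^2 ≤ N := by exact_mod_cast h3
    refine le_trans ?_ h4
    rw [← sq_abs (a i)]
    exact Int.le_self_sq |a i|
  choose N hN using key
  refine (Set.finite_Icc (fun i => - N i) N).subset fun a ha => ?_
  exact ⟨fun i => (abs_le.1 (hN i a ha)).1, fun i => (abs_le.1 (hN i a ha)).2⟩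

lemma Th_regular (hQ : IsSymmBilin Q) (hpos : ∀ x : Fin n → ℝ, x ≠ 0 → 0 < Q x x)
    (hv : ∀ a x, Q (v a) x = dotp a x) (hc : ∀ a, |c a| ≤ S) :
    RegularFn (Th Q r v c) := by
  intro x0
  have hcont : Continuous fun y : Fin n → ℝ => Q (r + y) (r + y) :=
    (Qcont hQ).comp (continuous_const.add continuous_id)
  set K := Q (r + x0) (r + x0) + 1 with hK
  refine ⟨{y | Q (r + y) (r + y) < K},
    (isOpen_lt hcont continuous_const).mem_nhds (by simp [hK]), ?_⟩
  -- threshold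
  set A := Q (v (zc 0)) (v (zc 0)) with hA
  set M := 2 * (2 * A + 2 * K + 4 * S) + 2 * K with hM
  have hfin := fin_small hQ hpos hv (M + A)
  set F := hfin.toFinset with hF
  have hA0 : 0 ≤ A := Qnn hQ hpos _
  have hS0 : 0 ≤ S := (abs_nonneg _).trans (hc 0)
  have hK0 : 0 ≤ K := by have := Qnn hQ hpos (r + x0); linarith
  have h0F : (0 : Fin n → ℤ) ∈ F := by
    rw [hF, Set.Finite.mem_toFinset]
    show A ≤ M + A
    linarith
  have hmaj : ∀ y, Q (r + y) (r + y) < K → ∀ a, a ∉ F → pc Q r v c a y ≤ pc Q r v c 0 y := by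
    intro y hy a ha
    have ha' : M < Q (v (zc a)) (v (zc a)) := by
      by_contra hcon
      apply ha
      rw [hF, Set.Finite.mem_toFinset]
      show Q (v (zc a)) (v (zc a)) ≤ M + A
      linarith [not_lt.1 hcon]
    rw [pc_eq hQ hv, pc_eq hQ hv]
    have e1 : v (zc a) = (v (zc a) - r - y) + (r + y) := by abel
    have h1 := Q_le_two hQ hpos (v (zc a) - r - y) (r + y)
    rw [← e1] at h1
    have h2 := Q_le_two hQ hpos (v (zc 0)) (-(r + y))
    have e2 : v (zc 0) + -(r + y) = v (zc 0) - r - y := by abel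
    rw [e2, Qnegl hQ, Qnegr hQ] at h2
    have h3 := (abs_le.1 (hc a)).2
    have h4 := (abs_le.1 (hc 0)).1
    linarith
  obtain ⟨k, hk⟩ : ∃ k, F.card = k + 1 :=
    Nat.exists_eq_succ_of_ne_zero (Finset.card_ne_zero_of_mem h0F)
  let eq := (F.equivFin.trans (finCongr hk)).symm
  refine ⟨k, fun i => (eq i).1,
    fun i => - (1/2) * Q (v (zc (eq i).1) - r) (v (zc (eq i).1) - r) + c (eq i).1, fun y hy => ?_⟩
  have hpc : ∀ i, dotp (fun j => (((eq i).1 j : ℤ) : ℝ)) y +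
      (- (1/2) * Q (v (zc (eq i).1) - r) (v (zc (eq i).1) - r) + c (eq i).1)
      = pc Q r v c (eq i).1 y := by
    intro i
    unfold pc
    show dotp (zc (eq i).1) y + _ = _
    ring
  simp only [hpc]
  apply le_antisymm
  · refine ciSup_le fun a => ?_
    have hmem : ∀ a ∈ F, pc Q r v c a y ≤ Finset.univ.sup' Finset.univ_nonempty
        (fun i => pc Q r v c (eq i).1 y) := by
      intro a ha
      have := Finset.le_sup' (fun i => pc Q r v c (eq i).1 y) (Finset.mem_univ (eq.symm ⟨a, ha⟩))
      rwa [Equiv.apply_symm_apply] at this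
    by_cases ha : a ∈ F
    · exact hmem a ha
    · exact (hmaj y hy a ha).trans (hmem 0 h0F)
  · exact Finset.sup'_le _ _ fun i _ => le_ciSup (pc_bdd hQ hpos hv hc y) (eq i).1

lemma lat_zero {Λ : Set (Fin n → ℝ)} (hΛ : IsLattice Λ) : (0 : Fin n → ℝ) ∈ Λ := by
  obtain ⟨e, rfl⟩ := hΛ
  exact ⟨0, by simp⟩

lemma lat_neg {Λ : Set (Fin n → ℝ)} (hΛ : IsLattice Λ) {x : Fin n → ℝ} (hx : x ∈ Λ) :
    -x ∈ Λ := by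
  obtain ⟨e, rfl⟩ := hΛ
  obtain ⟨c, rfl⟩ := hx
  exact ⟨-c, by simp⟩

lemma lat_add {Λ : Set (Fin n → ℝ)} (hΛ : IsLattice Λ) {x y : Fin n → ℝ} (hx : x ∈ Λ)
    (hy : y ∈ Λ) : x + y ∈ Λ := by
  obtain ⟨e, rfl⟩ := hΛ
  obtain ⟨c, rfl⟩ := hx
  obtain ⟨d, rfl⟩ := hy
  exact ⟨c + d, by simp [add_smul, Finset.sum_add_distrib]⟩

lemma dotp_add' (a b x : Fin n → ℝ) : dotp (a + b) x = dotp a x + dotp b x := by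
  simp [dotp, add_mul, Finset.sum_add_distrib]

lemma v_add (hQ : IsSymmBilin Q) (hpos : ∀ x : Fin n → ℝ, x ≠ 0 → 0 < Q x x)
    (hv : ∀ a x, Q (v a) x = dotp a x) (a b : Fin n → ℝ) : v (a + b) = v a + v b :=
  Qinj hQ hpos fun x => by rw [Qaddl hQ, hv, hv, hv, dotp_add']

lemma v_sub (hQ : IsSymmBilin Q) (hpos : ∀ x : Fin n → ℝ, x ≠ 0 → 0 < Q x x)
    (hv : ∀ a x, Q (v a) x = dotp a x) (a b : Fin n → ℝ) : v (a - b) = v a - v b := by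
  have := v_add hQ hpos hv (a - b) b
  rw [sub_add_cancel] at this
  rw [this, add_sub_cancel_right]

/-- lattice vectors come from integer vectors -/
lemma lat_int {Λ : Set (Fin n → ℝ)} (hQ : IsSymmBilin Q)
    (hpos : ∀ x : Fin n → ℝ, x ≠ 0 → 0 < Q x x)
    (hint : IntegralWrt Q Λ) (hv : ∀ a x, Q (v a) x = dotp a x) {l : Fin n → ℝ} (hl : l ∈ Λ) :
    ∃ m : Fin n → ℤ, v (zc m) = l := by
  have h : ∀ i : Fin n, ∃ k : ℤ, Q l (Pi.single i 1) = k := by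
    intro i
    obtain ⟨k, hk⟩ := hint l hl (Pi.single i 1)
    refine ⟨k, ?_⟩
    rw [← hk]
    congr 1
    funext j
    simp [Pi.single_apply]
  choose m hm using h
  refine ⟨m, Qinj hQ hpos fun x => ?_⟩
  rw [hv]
  have e : x = ∑ i, x i • (Pi.single i (1:ℝ) : Fin n → ℝ) := pi_eq_sum_univ' x
  have := map_sum (IsLinearMap.mk' _ (hQ.1 l))
        (fun i => x i • (Pi.single i (1:ℝ) : Fin n → ℝ)) Finset.univ
  rw [← e] at this
  simp only [IsLinearMap.mk'_apply, Qsmulr hQ, hm] at this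
  rw [this]
  simp [dotp, zc, mul_comm]

lemma inQ_iff {Λ : Set (Fin n → ℝ)} (hQ : IsSymmBilin Q)
    (hpos : ∀ x : Fin n → ℝ, x ≠ 0 → 0 < Q x x)
    (hv : ∀ a x, Q (v a) x = dotp a x) (m : Fin n → ℝ) : InQLat Λ Q m ↔ v m ∈ Λ := by
  constructor
  · rintro ⟨l, hl, h⟩
    have : v m = l := Qinj hQ hpos fun x => by rw [hv, h]
    rwa [this]
  · intro h
    exact ⟨v m, h, fun x => (hv m x).symm⟩

lemma zc_sub (a b : Fin n → ℤ) : zc (a - b) = zc a - zc b := by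
  funext i; simp [zc]
lemma zc_add (a b : Fin n → ℤ) : zc (a + b) = zc a + zc b := by
  funext i; simp [zc]

lemma Th_quasi {Λ : Set (Fin n → ℝ)} (hΛ : IsLattice Λ) (hQ : IsSymmBilin Q)
    (hpos : ∀ x : Fin n → ℝ, x ≠ 0 → 0 < Q x x)
    (hint : IntegralWrt Q Λ) (hv : ∀ a x, Q (v a) x = dotp a x) (hc : ∀ a, |c a| ≤ S)
    (hper : ∀ a m, v (zc m) ∈ Λ → c (a - m) = c a) :
    QuasiPeriodic Λ Q (fun x => Q x r) (Th Q r v c) := by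
  have half : ∀ l ∈ Λ, ∀ x, Th Q r v c (x + l) ≤
      Th Q r v c x + Q l x + (1/2) * Q l l + Q l r := by
    intro l hl x
    refine ciSup_le fun a => ?_
    obtain ⟨m, rfl⟩ := lat_int hQ hpos hint hv hl
    have h1 : pc Q r v c (a - m) x ≤ Th Q r v c x := le_ciSup (pc_bdd hQ hpos hv hc x) (a - m)
    unfold pc at h1 ⊢
    rw [hper a m hl, zc_sub, ← hv, v_sub hQ hpos hv] at h1
    rw [← hv]
    simp only [Qsubl hQ, Qsubr hQ, Qaddr hQ] at *
    rw [hQ.2 r (v (zc a)), hQ.2 (v (zc m)) (v (zc a)), hQ.2 r (v (zc m))] at *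
    linarith
  intro l hl x
  apply le_antisymm (half l hl x)
  have := half (-l) (lat_neg hΛ hl) (x + l)
  rw [add_neg_cancel_right] at this
  simp only [Qnegl hQ, Qnegr hQ, Qaddr hQ] at this
  show Th Q r v c x + Q l x + (1/2) * Q l l + Q l r ≤ _
  linarith

end helpers

/-- All tuples with small spread are coordinates of theta functions. -/
lemma main_aux {n : ℕ} (Λ : Set (Fin n → ℝ)) (hΛ : IsLattice Λ)
    (Q : (Fin n → ℝ) → (Fin n → ℝ) → ℝ) (hQ : IsSymmBilin Q)
    (hpos : ∀ x : Fin n → ℝ, x ≠ 0 → 0 < Q x x) (hint : IntegralWrt Q Λ)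
    (r : Fin n → ℝ) (v : (Fin n → ℝ) → (Fin n → ℝ))
    (hv : ∀ a x, Q (v a) x = dotp a x)
    (B : Finset (Fin n → ℤ))
    (hB : ∀ m : Fin n → ℤ, ∃! b, b ∈ B ∧
      InQLat Λ Q (fun i => (m i : ℝ) - (b i : ℝ))) :
    ∃ δ : ℝ, 0 < δ ∧ ∀ s : {b // b ∈ B} → ℝ, (∀ b b', s b' - s b ≤ δ) →
      s ∈ thetaCoordSet Λ Q r v B := by
  have hB' : ∀ m : Fin n → ℤ, ∃ b, (b ∈ B ∧ v (zc m) - v (zc b) ∈ Λ) ∧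
      ∀ b', b' ∈ B → v (zc m) - v (zc b') ∈ Λ → b' = b := by
    intro m
    obtain ⟨b, ⟨h1, h2⟩, h3⟩ := hB m
    have key : ∀ b : Fin n → ℤ, InQLat Λ Q (fun i => (m i : ℝ) - (b i : ℝ)) ↔
        v (zc m) - v (zc b) ∈ Λ := by
      intro b
      rw [← v_sub hQ hpos hv]
      exact inQ_iff hQ hpos hv (zc m - zc b)
    exact ⟨b, ⟨h1, (key b).1 h2⟩, fun b' hb' h => h3 b' ⟨hb', (key b').2 h⟩⟩
  choose β hβ hβu using hB'
  set G := 1 + ∑ i, Q (Pi.single i 1) (Pi.single i 1) with hG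
  have hGi : ∀ i, Q (Pi.single i 1) (Pi.single i 1) ≤ G := by
    intro i
    have := Finset.single_le_sum (f := fun i => Q (Pi.single i 1) (Pi.single i 1))
      (fun i _ => Qnn hQ hpos (Pi.single i 1)) (Finset.mem_univ i)
    linarith
  have hG0 : 0 < G := by
    have := Finset.sum_nonneg (fun i (_ : i ∈ Finset.univ) => Qnn hQ hpos (Pi.single i 1))
    linarith
  have hgap : ∀ a : Fin n → ℤ, v (zc a) ≠ 0 → 1 / G ≤ Q (v (zc a)) (v (zc a)) := by
    intro a ha
    have ha0 : ∃ i, a i ≠ 0 := by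
      by_contra hcon
      push Not at hcon
      apply ha
      refine Qinj hQ hpos fun x => ?_
      rw [hv, hQ.2 0 x]
      have := Qsmulr hQ 0 x 0
      simp at this
      rw [this]
      simp [dotp, zc, hcon]
    obtain ⟨i, hi⟩ := ha0
    have h1 := Qcs hQ hpos (v (zc a)) (Pi.single i 1)
    rw [hv, dotp_single] at h1
    have h2 : (1 : ℝ) ≤ (zc a i)^2 := by
      have : (1 : ℤ) ≤ (a i)^2 := by
        have : 0 < (a i)^2 := by positivity
        omega
      show (1 : ℝ) ≤ ((a i : ℤ) : ℝ)^2
      exact_mod_cast this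
    rw [div_le_iff₀ hG0]
    exact h2.trans (h1.trans (mul_le_mul_of_nonneg_left (hGi i) (Qnn hQ hpos _)))
  refine ⟨1 / (2 * G), by positivity, fun s hs => ?_⟩
  set c : (Fin n → ℤ) → ℝ := fun a => s ⟨β a, (hβ a).1⟩ with hcdef
  have hc : ∀ a, |c a| ≤ ∑ b, |s b| := fun a =>
    Finset.single_le_sum (f := fun b => |s b|) (fun _ _ => abs_nonneg _) (Finset.mem_univ _)
  have hβeq : ∀ a b, ∀ hb : b ∈ B, v (zc a) - v (zc b) ∈ Λ → c a = s ⟨b, hb⟩ := by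
    intro a b hb h
    simp only [hcdef]
    congr 2
    exact (hβu a b hb h).symm
  have hper : ∀ a m, v (zc m) ∈ Λ → c (a - m) = c a := by
    intro a m hm
    refine hβeq (a - m) (β a) (hβ a).1 ?_
    rw [zc_sub, v_sub hQ hpos hv]
    have := lat_add hΛ (hβ a).2 (lat_neg hΛ hm)
    convert this using 1
    abel
  refine ⟨Th Q r v c, ⟨Th_convex hQ hpos hv hc, Th_regular hQ hpos hv hc,
    Th_quasi hΛ hQ hpos hint hv hc hper⟩, fun b => ?_⟩
  obtain ⟨b, hb⟩ := b
  -- the generator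
  have hgle : ∀ y, ∀ l, dotp (fun i => (b i : ℝ)) y + Q l y
      - (1/2) * Q (l + v (zc b) - r) (l + v (zc b) - r) ≤ Pq Q r y := by
    intro y l
    have := complete_sq hQ (l + v (zc b)) y r
    rw [Qaddl hQ, hv] at this
    have h := Qnn hQ hpos (l + v (zc b) - r - y)
    change dotp (zc b) y + _ - _ ≤ _
    linarith
  have hlow : ∀ y, s ⟨b, hb⟩ ≤ Th Q r v c y - thetaGenOf Λ Q r v b y := by
    intro y
    have : thetaGenOf Λ Q r v b y ≤ Th Q r v c y - s ⟨b, hb⟩ := by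
      apply csSup_le
      · exact ⟨_, 0, lat_zero hΛ, rfl⟩
      · rintro _ ⟨l, hl, rfl⟩
        obtain ⟨m, rfl⟩ := lat_int hQ hpos hint hv hl
        have h1 : pc Q r v c (m + b) y ≤ Th Q r v c y :=
          le_ciSup (pc_bdd hQ hpos hv hc y) (m + b)
        have h2 : c (m + b) = s ⟨b, hb⟩ := by
          refine hβeq _ _ hb ?_
          rw [zc_add, v_add hQ hpos hv, add_sub_cancel_right]
          exact hl
        unfold pc at h1
        rw [h2, zc_add, v_add hQ hpos hv, dotp_add', ← hv (zc m)] at h1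
        change dotp (zc b) y + _ - (1/2) * Q (v (zc m) + v (zc b) - r) (v (zc m) + v (zc b) - r) ≤ _
        linarith
    linarith
  have hatt : Th Q r v c (v (zc b) - r) - thetaGenOf Λ Q r v b (v (zc b) - r) ≤ s ⟨b, hb⟩ := by
    set y := v (zc b) - r with hy
    have h1 : Pq Q r y ≤ thetaGenOf Λ Q r v b y := by
      apply le_csSup
      · exact ⟨Pq Q r y, by rintro _ ⟨l, hl, rfl⟩; exact hgle y l⟩
      · refine ⟨0, lat_zero hΛ, ?_⟩
        change _ = dotp (zc b) y + Q 0 y - (1/2) * Q (0 + v (zc b) - r) (0 + v (zc b) - r)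
        have := complete_sq hQ (0 + v (zc b)) y r
        rw [Qaddl hQ, hv] at this
        have h0 : 0 + v (zc b) - r - y = 0 := by rw [hy]; abel
        have h00 : Q (0 : Fin n → ℝ) 0 = 0 := by
          have := Qsmulr hQ 0 0 (0 : Fin n → ℝ)
          simpa using this
        rw [h0, h00] at this
        linarith
    have h2 : Th Q r v c y ≤ Pq Q r y + s ⟨b, hb⟩ := by
      refine ciSup_le fun a => ?_
      rw [pc_eq hQ hv]
      have e : v (zc a) - r - y = v (zc (a - b)) := by
        rw [hy, zc_sub, v_sub hQ hpos hv]; abel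
      rw [e]
      by_cases h0 : v (zc (a - b)) = 0
      · have : c a = s ⟨b, hb⟩ := by
          refine hβeq a b hb ?_
          rw [← v_sub hQ hpos hv, ← zc_sub, h0]
          exact lat_zero hΛ
        have := Qnn hQ hpos (v (zc (a - b)))
        linarith
      · have h3 := hgap _ h0
        have h4 : c a - s ⟨b, hb⟩ ≤ 1 / (2 * G) := hs _ _
        have h5 : 1 / (2 * G) = (1/2) * (1 / G) := by field_simp
        linarith
    linarith
  symm
  apply IsLeast.csInf_eq
  refine ⟨⟨v (zc b) - r, le_antisymm (hlow _) hatt⟩, ?_⟩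
  rintro _ ⟨y, rfl⟩
  exact hlow y

theorem stmt12 {n : ℕ} (Λ : Set (Fin n → ℝ)) (hΛ : IsLattice Λ)
    (Q : (Fin n → ℝ) → (Fin n → ℝ) → ℝ) (hQ : IsSymmBilin Q)
    (hpos : ∀ x : Fin n → ℝ, x ≠ 0 → 0 < Q x x) (hint : IntegralWrt Q Λ)
    (r : Fin n → ℝ) (v : (Fin n → ℝ) → (Fin n → ℝ))
    (hv : ∀ a x, Q (v a) x = dotp a x)
    (B : Finset (Fin n → ℤ))
    (hB : ∀ m : Fin n → ℤ, ∃! b, b ∈ B ∧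
      InQLat Λ Q (fun i => (m i : ℝ) - (b i : ℝ))) :
    (0 ∈ thetaCoordSet Λ Q r v B) ∧
    (∃ ε : ℝ, 0 < ε ∧ ∀ b : {b // b ∈ B}, Pi.single b ε ∈ thetaCoordSet Λ Q r v B) ∧
    (interior (thetaCoordSet Λ Q r v B)).Nonempty := by
  obtain ⟨δ, hδ, H⟩ := main_aux Λ hΛ Q hQ hpos hint r v hv B hB
  refine ⟨H 0 (by simp [hδ.le]), ⟨δ, hδ, fun b => H _ ?_⟩, ⟨0, ?_⟩⟩
  · intro b1 b2
    have h1 : (Pi.single b δ : {b // b ∈ B} → ℝ) b2 ≤ δ := by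
      rw [Pi.single_apply]; split_ifs <;> linarith
    have h2 : 0 ≤ (Pi.single b δ : {b // b ∈ B} → ℝ) b1 := by
      rw [Pi.single_apply]; split_ifs <;> linarith
    linarith
  · rw [mem_interior_iff_mem_nhds]
    refine Filter.mem_of_superset (Metric.ball_mem_nhds 0 (half_pos hδ)) fun s hs => H s ?_
    intro b b'
    rw [mem_ball_zero_iff] at hs
    have h1 := abs_le.1 ((norm_le_pi_norm s b).trans hs.le)
    have h2 := abs_le.1 ((norm_le_pi_norm s b').trans hs.le)
    linarith [h1.1, h2.2]
end
end

section
/- Let Q be a positive definite symmetric bilinear form on ℝ^n such that Q(v_a, x) = ⟨a, x⟩ defines v_a ∈ ℝ^n for each a ∈ ℝ^n, and fix r ∈ ℝ^n. Define Ξ(x) = sup_{a∈ℤ^n}(⟨a,x⟩ − (1/2)Q(v_a − r, v_a − r)). Then Ξ(x) is finite and the supremum is attained for every x, and Ξ satisfies the quasi-periodicity with respect to the overlattice Λ̃ = {η ∈ ℝ^n : Q(η, m) ∈ ℤ for all m ∈ ℤ^n}: for every η ∈ Λ̃ and x ∈ ℝ^n, Ξ(x+η) = Ξ(x) + Q(η,x)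 + (1/2)Q(η,η) + Q(η,r). -/
noncomputable section

theorem xi_aux {n : ℕ} (Q : (Fin n → ℝ) → (Fin n → ℝ) → ℝ) (hQ : IsSymmBilin Q)
    (v : (Fin n → ℝ) → (Fin n → ℝ)) (hv : ∀ a x, Q (v a) x = dotp a x)
    (r x a : Fin n → ℝ) :
    dotp a x - (1/2) * Q (v a - r) (v a - r) =
      (1/2) * Q (x + r) (x + r) - (1/2) * Q r r
        - (1/2) * Q (v a - (x + r)) (v a - (x + r)) := by
  obtain ⟨hl, hs⟩ := hQ
  have hsub : ∀ x y z, Q x (y - z) = Q x y - Q x z := fun x y z => (hl x).map_sub y z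
  have hadd : ∀ x y z, Q x (y + z) = Q x y + Q x z := fun x y z => (hl x).map_add y z
  have hsub' : ∀ x y z, Q (y - z) x = Q y x - Q z x := fun x y z => by
    rw [hs, hsub, hs x y, hs x z]
  have hadd' : ∀ x y z, Q (y + z) x = Q y x + Q z x := fun x y z => by
    rw [hs, hadd, hs x y, hs x z]
  rw [← hv]
  simp only [hsub, hsub', hadd, hadd']
  rw [hs x (v a), hs r (v a), hs r x]
  ring

theorem stmt14 {n : ℕ} (Q : (Fin n → ℝ) → (Fin n → ℝ) → ℝ) (hQ : IsSymmBilin Q)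
    (hpos : ∀ x : Fin n → ℝ, x ≠ 0 → 0 < Q x x)
    (v : (Fin n → ℝ) → (Fin n → ℝ)) (hv : ∀ a x, Q (v a) x = dotp a x)
    (r : Fin n → ℝ) :
    (∀ x : Fin n → ℝ, ∃ a0 : Fin n → ℤ,
      IsGreatest
        {t | ∃ a : Fin n → ℤ, t = dotp (fun i => (a i : ℝ)) x
          - (1/2) * Q (v (fun i => (a i : ℝ)) - r) (v (fun i => (a i : ℝ)) - r)}
        (dotp (fun i => (a0 i : ℝ)) x
          - (1/2) * Q (v (fun i => (a0 i : ℝ)) - r) (v (fun i => (a0 i : ℝ)) - r))) ∧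
    (∀ η : Fin n → ℝ, (∀ m : Fin n → ℤ, ∃ k : ℤ, Q η (fun i => (m i : ℝ)) = (k : ℝ)) →
      ∀ x : Fin n → ℝ,
        XiFn Q v r (x + η) = XiFn Q v r x + Q η x + (1/2) * Q η η + Q η r) := by
  have haux := xi_aux Q hQ v hv r
  obtain ⟨hl, hs⟩ := hQ
  have hsub : ∀ x y z, Q x (y - z) = Q x y - Q x z := fun x y z => (hl x).map_sub y z
  have hadd : ∀ x y z, Q x (y + z) = Q x y + Q x z := fun x y z => (hl x).map_add y z
  have hsub' : ∀ x y z, Q (y - z) x = Q y x - Q z x := fun x y z => by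
    rw [hs, hsub, hs x y, hs x z]
  have hadd' : ∀ x y z, Q (y + z) x = Q y x + Q z x := fun x y z => by
    rw [hs, hadd, hs x y, hs x z]
  have hnn : ∀ x, 0 ≤ Q x x := by
    intro x
    by_cases h : x = 0
    · subst h
      exact le_of_eq ((hl 0).map_zero).symm
    · exact (hpos x h).le
  have hcs : ∀ x y, |Q x y| ≤ (1/2) * (Q x x + Q y y) := by
    intro x y
    have h1 := hnn (x + y)
    have h2 := hnn (x - y)
    simp only [hsub, hsub', hadd, hadd'] at h1 h2
    rw [hs y x] at h1 h2
    rw [abs_le]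
    constructor <;> linarith
  have hdot : ∀ (a : Fin n → ℝ) i, dotp a (Pi.single i 1) = a i := by
    intro a i
    simp [dotp, Pi.single_apply]
  have main : ∀ x : Fin n → ℝ, ∃ a0 : Fin n → ℤ, ∀ a : Fin n → ℤ,
      dotp (fun i => (a i : ℝ)) x
          - (1/2) * Q (v (fun i => (a i : ℝ)) - r) (v (fun i => (a i : ℝ)) - r) ≤
      dotp (fun i => (a0 i : ℝ)) x
          - (1/2) * Q (v (fun i => (a0 i : ℝ)) - r) (v (fun i => (a0 i : ℝ)) - r) := by
    intro x
    set f : (Fin n → ℤ) → ℝ := fun a => dotp (fun i => (a i : ℝ)) x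
          - (1/2) * Q (v (fun i => (a i : ℝ)) - r) (v (fun i => (a i : ℝ)) - r) with hf
    set C : ℝ := Q (x + r) (x + r) - Q r r - 2 * f 0 with hC
    have hfin : {a : Fin n → ℤ | f 0 ≤ f a}.Finite := by
      refine (Set.Finite.pi' (t := fun i => Set.Icc
        ⌊Q (x + r) (Pi.single i 1) - (1/2) * (C + Q (Pi.single i 1) (Pi.single i 1))⌋
        ⌈Q (x + r) (Pi.single i 1) + (1/2) * (C + Q (Pi.single i 1) (Pi.single i 1))⌉)
        (fun i => Set.finite_Icc _ _)).subset ?_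
      intro a ha i
      have ha' : f 0 ≤ f a := ha
      have h1 : f a = _ := haux x (fun i => (a i : ℝ))
      have h2 := hcs (v (fun i => (a i : ℝ)) - (x + r)) (Pi.single i 1)
      rw [hsub' _ (v _), hv, hdot, abs_le] at h2
      obtain ⟨h3, h4⟩ := h2
      constructor
      · have := Int.floor_le (Q (x + r) (Pi.single i 1)
          - (1/2) * (C + Q (Pi.single i 1) (Pi.single i 1)))
        have h : ((⌊Q (x + r) (Pi.single i 1)
          - (1/2) * (C + Q (Pi.single i 1) (Pi.single i 1))⌋ : ℤ) : ℝ) ≤ (a i : ℝ) := by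
          linarith
        exact_mod_cast h
      · have := Int.le_ceil (Q (x + r) (Pi.single i 1)
          + (1/2) * (C + Q (Pi.single i 1) (Pi.single i 1)))
        have h : (a i : ℝ) ≤ ((⌈Q (x + r) (Pi.single i 1)
          + (1/2) * (C + Q (Pi.single i 1) (Pi.single i 1))⌉ : ℤ) : ℝ) := by
          linarith
        exact_mod_cast h
    obtain ⟨a0, h0, hmax⟩ := Set.exists_max_image _ f hfin ⟨0, le_refl (f 0)⟩
    refine ⟨a0, fun a => ?_⟩
    change f a ≤ f a0
    by_cases h : f 0 ≤ f a
    · exact hmax a h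
    · exact (not_le.mp h).le.trans h0
  refine ⟨fun x => ?_, ?_⟩
  · obtain ⟨a0, h⟩ := main x
    refine ⟨a0, ⟨a0, rfl⟩, ?_⟩
    rintro t ⟨a, rfl⟩
    exact h a
  · intro η hη x
    have hk : ∀ i, ∃ k : ℤ, Q η (Pi.single i 1) = (k : ℝ) := by
      intro i
      obtain ⟨k, hk⟩ := hη (Pi.single i 1)
      refine ⟨k, ?_⟩
      rw [← hk]
      congr 1
      ext j
      by_cases h : j = i
      · subst h; simp
      · simp [h]
    choose k hk using hk
    have hηdot : ∀ y, Q η y = dotp (fun i => (k i : ℝ)) y := by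
      intro y
      have h1 : y = ∑ i, y i • (Pi.single i (1 : ℝ) : Fin n → ℝ) := by
        ext j
        simp [Finset.sum_apply, Pi.single_apply]
      have h2 := map_sum (IsLinearMap.mk' (Q η) (hl η))
        (fun i => y i • (Pi.single i (1 : ℝ) : Fin n → ℝ)) Finset.univ
      rw [← h1] at h2
      change Q η y = _ at h2
      rw [h2, dotp]
      refine Finset.sum_congr rfl fun i _ => ?_
      change Q η (y i • (Pi.single i (1 : ℝ) : Fin n → ℝ)) = _
      rw [(hl η).map_smul, hk, smul_eq_mul, mul_comm]
    have hva : ∀ a : Fin n → ℤ, v (fun i => ((a + k) i : ℝ)) = v (fun i => (a i : ℝ)) + η := by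
      intro a
      by_contra hne
      have h := hpos _ (sub_ne_zero.mpr hne)
      have hz : ∀ y, Q (v (fun i => ((a + k) i : ℝ)) - (v (fun i => (a i : ℝ)) + η)) y = 0 := by
        intro y
        rw [hsub', hadd', hv, hv, hηdot]
        simp [dotp, add_mul, Finset.sum_add_distrib]
      rw [hz] at h
      exact lt_irrefl _ h
    have hshift : ∀ a : Fin n → ℤ,
        dotp (fun i => ((a + k) i : ℝ)) (x + η) - (1/2) *
          Q (v (fun i => ((a + k) i : ℝ)) - r) (v (fun i => ((a + k) i : ℝ)) - r) =
        dotp (fun i => (a i : ℝ)) x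
          - (1/2) * Q (v (fun i => (a i : ℝ)) - r) (v (fun i => (a i : ℝ)) - r)
          + Q η x + (1/2) * Q η η + Q η r := by
      intro a
      rw [haux, haux, hva]
      have : v (fun i => (a i : ℝ)) + η - (x + η + r) = v (fun i => (a i : ℝ)) - (x + r) := by
        abel
      rw [this]
      simp only [hadd, hadd']
      rw [hs x η, hs r η]
      ring
    obtain ⟨a0, h0⟩ := main x
    have e1 : XiFn Q v r x = _ := IsGreatest.csSup_eq
      ⟨⟨a0, rfl⟩, by rintro t ⟨a, rfl⟩; exact h0 a⟩
    have e2 : XiFn Q v r (x + η) = _ := IsGreatest.csSup_eq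
      ⟨⟨a0 + k, rfl⟩, by
        rintro t ⟨a, rfl⟩
        have h1 := hshift (a - k)
        rw [sub_add_cancel] at h1
        rw [h1, hshift a0]
        have := h0 (a - k)
        linarith⟩
    rw [e1, e2, hshift a0]
end
end

section
/- Let Λ be a lattice in ℝ^n, Q a positive semidefinite symmetric bilinear form on ℝ^n, α : ℝ^n → ℝ linear, and Θ : ℝ^n → ℝ a convex function satisfying the quasi-periodicity condition for (Q, α). If λ'' ∈ Λ satisfies Q(λ'', λ'') = 0, then Θ(x + tλ'') = Θ(x) + t·α(λ'') for all x ∈ ℝ^n and all t ∈ ℝ; that is, Θ is affine with slope α(λ'') along the direction λ''. -/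
noncomputable section

theorem stmt15 {n : ℕ} (Λ : Set (Fin n → ℝ)) (hΛ : IsLattice Λ)
    (Q : (Fin n → ℝ) → (Fin n → ℝ) → ℝ) (hQ : IsSymmBilin Q)
    (hpsd : ∀ x : Fin n → ℝ, 0 ≤ Q x x)
    (α : (Fin n → ℝ) → ℝ) (hα : IsLinearMap ℝ α)
    (Θ : (Fin n → ℝ) → ℝ) (hconv : ConvexOn ℝ Set.univ Θ)
    (hqp : QuasiPeriodic Λ Q α Θ)
    (l'' : Fin n → ℝ) (hl'' : l'' ∈ Λ) (hQl : Q l'' l'' = 0) :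
    ∀ (x : Fin n → ℝ) (t : ℝ), Θ (x + t • l'') = Θ x + t * α l'' := by
  have hlin := hQ.1 l''
  have hQ0 : ∀ y, Q l'' y = 0 := by
    intro y
    have key : ∀ s : ℝ, 0 ≤ Q y y + 2 * s * Q l'' y := by
      intro s
      have h := hpsd (y + s • l'')
      have h1 : Q (y + s • l'') (y + s • l'') = Q y y + 2 * s * Q l'' y := by
        rw [(hQ.1 (y + s • l'')).map_add, (hQ.1 (y + s • l'')).map_smul,
          hQ.2 (y + s • l'') y, hQ.2 (y + s • l'') l'', (hQ.1 y).map_add,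
          (hQ.1 y).map_smul, hlin.map_add, hlin.map_smul, hQl, hQ.2 y l'']
        simp only [smul_eq_mul]
        ring
      rwa [h1] at h
    by_contra hne
    have h := key (-(Q y y + 1) / (2 * Q l'' y))
    have h2 : 2 * (-(Q y y + 1) / (2 * Q l'' y)) * Q l'' y = -(Q y y + 1) := by
      field_simp
    linarith
  have step : ∀ x, Θ (x + l'') = Θ x + α l'' := by
    intro x
    rw [hqp l'' hl'' x, hQ0, hQ0]
    ring
  have up : ∀ (N : ℕ) (x : Fin n → ℝ), Θ (x + (N : ℝ) • l'') = Θ x + N * α l'' := by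
    intro N
    induction N with
    | zero => intro x; simp
    | succ k ih =>
      intro x
      have h : x + ((k + 1 : ℕ) : ℝ) • l'' = (x + (k : ℝ) • l'') + l'' := by
        push_cast
        module
      rw [h, step, ih]
      push_cast
      ring
  have le : ∀ (x : Fin n → ℝ) (t : ℝ), Θ (x + t • l'') ≤ Θ x + t * α l'' := by
    intro x t
    obtain ⟨N, hN⟩ := exists_nat_gt |t|
    have hNpos : (0 : ℝ) < N := lt_of_le_of_lt (abs_nonneg t) hN
    have hb := abs_lt.mp hN
    have hu := up N x
    have hd := up N (x - (N : ℝ) • l'')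
    rw [sub_add_cancel] at hd
    have ha0 : 0 ≤ (N + t) / (2 * N) := div_nonneg (by linarith) (by linarith)
    have hb0 : 0 ≤ (N - t) / (2 * N) := div_nonneg (by linarith) (by linarith)
    have hab : (N + t) / (2 * N) + (N - t) / (2 * N) = 1 := by
      field_simp
      ring
    have hdiff : (N + t) / (2 * N) * N - (N - t) / (2 * N) * N = t := by
      field_simp
      ring
    have hc := hconv.2 (Set.mem_univ (x + (N : ℝ) • l'')) (Set.mem_univ (x - (N : ℝ) • l''))
      ha0 hb0 hab
    generalize (N + t) / (2 * N) = a at *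
    generalize (N - t) / (2 * N) = b at *
    have hx : a • (x + (N : ℝ) • l'') + b • (x - (N : ℝ) • l'') = x + t • l'' := by
      rw [← hdiff]
      have : b = 1 - a := by linarith
      subst this
      module
    rw [hx, hu, show Θ (x - (N : ℝ) • l'') = Θ x - N * α l'' by linarith] at hc
    simp only [smul_eq_mul] at hc
    have e : a * (Θ x + N * α l'') + b * (Θ x - N * α l'')
        = (a + b) * Θ x + (a * N - b * N) * α l'' := by ring
    rw [e, hab, hdiff] at hc
    linarith
  intro x t
  have h1 := le x t
  have h2 := le (x + t • l'') (-t)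
  rw [show x + t • l'' + (-t) • l'' = x by module] at h2
  linarith
end
end

section
/- Let Λ be a lattice in ℝ^n, let Q be a positive semidefinite symmetric bilinear form on ℝ^n that is integral with respect to Λ, fix r ∈ ℝ^n, and let Θ : ℝ^n → ℝ be a convex function satisfying the quasi-periodicity condition for (Q, Q(·,r)). Then Θ is invariant along the kernel of Q: Θ(x + v) = Θ(x) for every x ∈ ℝ^n and every v ∈ ℝ^n with Q(v, y) = 0 for all y ∈ ℝ^n. -/
noncomputable section

theorem stmt16 {n : ℕ} (Λ : Set (Fin n → ℝ)) (hΛ : IsLattice Λ)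
    (Q : (Fin n → ℝ) → (Fin n → ℝ) → ℝ) (hQ : IsSymmBilin Q)
    (hpsd : ∀ x : Fin n → ℝ, 0 ≤ Q x x) (hint : IntegralWrt Q Λ)
    (r : Fin n → ℝ) (Θ : (Fin n → ℝ) → ℝ) (hconv : ConvexOn ℝ Set.univ Θ)
    (hqp : QuasiPeriodic Λ Q (fun x => Q x r) Θ) :
    ∀ (x v : Fin n → ℝ), (∀ y, Q v y = 0) → Θ (x + v) = Θ x := by
  obtain ⟨hlin, hsymm⟩ := hQ
  obtain ⟨e, rfl⟩ := hΛ
  have hadd : ∀ x y z, Q x (y + z) = Q x y + Q x z := fun x => (hlin x).map_add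
  have hadd' : ∀ x y z, Q (x + y) z = Q x z + Q y z := fun x y z => by
    rw [hsymm, hadd, hsymm z x, hsymm z y]
  -- boundedness on the fundamental domain
  have hcΘ : Continuous Θ := by
    rw [← continuousOn_univ]
    exact hconv.continuousOn isOpen_univ
  have hcQ : Continuous (fun y => Q y r) := by
    have h : (fun y => Q y r) = (hlin r).mk' (Q r) := by
      funext y
      simp [hsymm y r]
    rw [h]
    exact LinearMap.continuous_of_finiteDimensional _
  have hK : IsCompact ((fun t : Fin n → ℝ => ∑ i, t i • e i) '' Set.Icc 0 1) :=
    isCompact_Icc.image (by fun_prop)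
  obtain ⟨M, hM⟩ := hK.bddAbove_image (f := fun y => Θ y - Q y r) (hcΘ.sub hcQ).continuousOn
  have hG : ∀ y, Θ y - (1/2) * Q y y - Q y r ≤ M := by
    intro y
    set l : Fin n → ℝ := ∑ i, ((⌊e.repr y i⌋ : ℤ) : ℝ) • e i with hl
    set z : Fin n → ℝ := ∑ i, (Int.fract (e.repr y i)) • e i with hz
    have hy : y = z + l := by
      rw [hl, hz, ← Finset.sum_add_distrib]
      conv_lhs => rw [← e.sum_repr y]
      refine Finset.sum_congr rfl fun i _ => ?_
      rw [← add_smul, Int.fract_add_floor]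
    have h1 := hqp l ⟨fun i => ⌊e.repr y i⌋, rfl⟩ z
    have h2 : Θ z - Q z r ≤ M := hM ⟨z, ⟨fun i => Int.fract (e.repr y i),
      ⟨fun i => Int.fract_nonneg _, fun i => (Int.fract_lt_one _).le⟩, rfl⟩, rfl⟩
    have h3 := hpsd z
    simp only at h1
    rw [hy, h1]
    simp only [hadd, hadd']
    rw [hsymm z l]
    linarith
  have key : ∀ (x v : Fin n → ℝ), (∀ y, Q v y = 0) → Θ (x + v) ≤ Θ x := by
    intro x v hv
    by_contra! hlt
    set B := M + (1/2) * Q x x + Q x r with hB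
    obtain ⟨N, hN⟩ := exists_nat_gt ((B - Θ x) / (Θ (x + v) - Θ x))
    rw [div_lt_iff₀ (by linarith)] at hN
    have hk : (0:ℝ) < (N:ℝ) + 1 := by positivity
    set k : ℝ := (N:ℝ) + 1 with hkd
    have hkv : ∀ y, Q (k • v) y = 0 := fun y => by
      rw [hsymm, (hlin y).map_smul, hsymm, hv, smul_zero]
    have h1 : Θ (x + k • v) ≤ B := by
      have := hG (x + k • v)
      simp only [hadd, hadd', hkv, hsymm x (k • v)] at this
      linarith
    have hk1 : 1 / k ≤ 1 := by
      rw [div_le_one hk]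
      simp [hkd]
    have h2 := hconv.2 (Set.mem_univ x) (Set.mem_univ (x + k • v))
      (show 0 ≤ 1 - 1 / k by linarith) (show 0 ≤ 1 / k by positivity) (by ring)
    have h3 : (1 - 1 / k) • x + (1 / k) • (x + k • v) = x + v := by
      rw [smul_add, smul_smul, one_div_mul_cancel hk.ne', one_smul, sub_smul, one_smul]
      abel
    rw [h3] at h2
    simp only [smul_eq_mul] at h2
    have h4 : k * Θ (x + v) ≤ (k - 1) * Θ x + Θ (x + k • v) := by
      have := mul_le_mul_of_nonneg_left h2 hk.le
      have h5 : k * ((1 - 1 / k) * Θ x + 1 / k * Θ (x + k • v))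
          = (k - 1) * Θ x + Θ (x + k • v) := by
        field_simp
      linarith
    rw [hkd] at h4 h1
    nlinarith
  intro x v hv
  refine le_antisymm (key x v hv) ?_
  have h := key (x + v) (-v) (fun y => by
    rw [hsymm, (hlin y).map_neg, hsymm, hv, neg_zero])
  simpa using h
end
end

section
/- Let Λ be a lattice in ℝ^n, let Q be a positive semidefinite symmetric bilinear form on ℝ^n that is integral with respect to Λ, and let α : ℝ^n → ℝ be linear. Suppose α does not lie in Im(q_ℝ) + (ℤ^n)*, i.e. there exist no v ∈ ℝ^n and no c ∈ ℤ^n with α(x) = Q(v, x) + ⟨c, x⟩ for all x ∈ ℝ^n. Then there is no theta function for (Q, α): no convex regular function Θ : ℝ^n → ℝ satisfies the quasi-periodicity condition for (Q, α). -/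
noncomputable section

theorem stmt17_support {n : ℕ} (Θ : (Fin n → ℝ) → ℝ) (hc : ConvexOn ℝ Set.univ Θ)
    (hr : RegularFn Θ) :
    ∃ (c : Fin n → ℤ) (d : ℝ), ∀ y, dotp (fun i => (c i : ℝ)) y + d ≤ Θ y := by
  obtain ⟨U, hU, k, a, c, h⟩ := hr 0
  obtain ⟨i, -, hi⟩ := Finset.exists_mem_eq_sup' (Finset.univ_nonempty (α := Fin (k+1)))
    (fun i => dotp (fun j => (a i j : ℝ)) 0 + c i)
  refine ⟨a i, c i, fun y => ?_⟩
  have h0 : Θ 0 = c i := by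
    rw [h 0 (mem_of_mem_nhds hU), hi]; simp [dotp]
  have ht : Filter.Tendsto (fun t : ℝ => t • y) (nhdsWithin 0 (Set.Ioi 0)) (nhds 0) := by
    have : Filter.Tendsto (fun t : ℝ => t • y) (nhds 0) (nhds ((0:ℝ) • y)) :=
      (continuous_id.smul continuous_const).tendsto 0
    rw [zero_smul] at this
    exact this.mono_left nhdsWithin_le_nhds
  have h1 : ∀ᶠ t : ℝ in nhdsWithin 0 (Set.Ioi 0), t < 1 :=
    nhdsWithin_le_nhds (Iio_mem_nhds one_pos)
  obtain ⟨t, ⟨htU, ht1⟩, ht0⟩ := (((ht.eventually hU).and h1).and self_mem_nhdsWithin).exists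
  have ht0 : 0 < t := ht0
  have e1 : dotp (fun j => (a i j : ℝ)) (t • y) + c i ≤ Θ (t • y) := by
    rw [h _ htU]
    exact Finset.le_sup' (fun i => dotp (fun j => (a i j : ℝ)) (t • y) + c i) (Finset.mem_univ i)
  have e2 := hc.2 (Set.mem_univ (0 : Fin n → ℝ)) (Set.mem_univ y)
    (sub_nonneg.2 ht1.le) ht0.le (by ring)
  have e3 : dotp (fun j => (a i j : ℝ)) (t • y) = t * dotp (fun j => (a i j : ℝ)) y := by
    simp only [dotp, Finset.mul_sum, Pi.smul_apply, smul_eq_mul]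
    exact Finset.sum_congr rfl fun j _ => by ring
  simp only [smul_zero, zero_add, smul_eq_mul, h0] at e2
  rw [e3] at e1
  have : t * (dotp (fun j => (a i j : ℝ)) y + c i) ≤ t * Θ y := by linarith
  exact le_of_mul_le_mul_left this ht0

theorem stmt17 {n : ℕ} (Λ : Set (Fin n → ℝ)) (hΛ : IsLattice Λ)
    (Q : (Fin n → ℝ) → (Fin n → ℝ) → ℝ) (hQ : IsSymmBilin Q)
    (hpsd : ∀ x : Fin n → ℝ, 0 ≤ Q x x) (hint : IntegralWrt Q Λ)
    (α : (Fin n → ℝ) → ℝ) (hα : IsLinearMap ℝ α)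
    (hno : ¬ ∃ (v : Fin n → ℝ) (c : Fin n → ℤ),
      ∀ x, α x = Q v x + dotp (fun i => (c i : ℝ)) x) :
    ¬ ∃ Θ : (Fin n → ℝ) → ℝ, IsThetaFn Λ Q α Θ := by
  rintro ⟨Θ, hc, hr, hq⟩
  obtain ⟨c, d, hcd⟩ := stmt17_support Θ hc hr
  obtain ⟨hlin, hsym⟩ := hQ
  obtain ⟨e, rfl⟩ := hΛ
  let q : (Fin n → ℝ) →ₗ[ℝ] (Fin n → ℝ) →ₗ[ℝ] ℝ := LinearMap.mk₂ ℝ Q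
    (fun x y z => by rw [hsym, (hlin z).map_add, hsym z x, hsym z y])
    (fun a x z => by rw [hsym, (hlin z).map_smul, hsym z x])
    (fun x y z => (hlin x).map_add y z)
    (fun a x z => (hlin x).map_smul a z)
  have hqQ : ∀ x y, q x y = Q x y := fun x y => rfl
  let C : (Fin n → ℝ) →ₗ[ℝ] ℝ := ∑ i, (c i : ℝ) • LinearMap.proj i
  have hC : ∀ x, C x = dotp (fun i => (c i : ℝ)) x := by
    intro x; simp [C, dotp]
  let A : (Fin n → ℝ) →ₗ[ℝ] ℝ := hα.mk' α
  have hA : ∀ x, A x = α x := fun x => rfl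
  let β := A - C
  have hβ : ∀ x, β x = α x - dotp (fun i => (c i : ℝ)) x := by
    intro x; simp [β, hC, hA]
  -- lower bound on lattice points
  have hlow : ∀ m : Fin n → ℤ, d - Θ 0 ≤ 
      (1/2) * q (∑ i, (m i : ℝ) • e i) (∑ i, (m i : ℝ) • e i) + β (∑ i, (m i : ℝ) • e i) := by
    intro m
    have h1 := hq (∑ i, (m i : ℝ) • e i) ⟨m, rfl⟩ 0
    have h2 := hcd (∑ i, (m i : ℝ) • e i)
    rw [(hlin _).map_zero, zero_add] at h1
    rw [hβ, hqQ]
    linarith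
  -- bound on the fundamental domain
  let P : (Fin n → ℝ) → ℝ := fun s =>
    (1/2) * q (∑ i, s i • e i) (∑ i, s i • e i) - β (∑ i, s i • e i)
  have hP : Continuous P := by
    have hs : Continuous fun s : Fin n → ℝ => ∑ i, s i • e i := by fun_prop
    have hb : Continuous fun x => β x := β.continuous_of_finiteDimensional
    have hqq : Continuous fun s : Fin n → ℝ => q (∑ i, s i • e i) (∑ i, s i • e i) := by
      simp only [map_sum, map_smul, LinearMap.sum_apply, LinearMap.smul_apply, smul_eq_mul]
      fun_prop
    exact (continuous_const.mul hqq).sub (hb.comp hs)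
  obtain ⟨M, hM⟩ := (isCompact_Icc (a := (0 : Fin n → ℝ)) (b := 1)).bddAbove_image hP.continuousOn
  have hker : ∀ x ∈ LinearMap.ker q, -(M - d + Θ 0) ≤ β x := by
    intro x hx
    have hx0 : q x = 0 := hx
    let s := e.repr x
    let f : Fin n → ℝ := fun i => Int.fract (s i)
    have hf : f ∈ Set.Icc (0 : Fin n → ℝ) 1 :=
      ⟨fun i => Int.fract_nonneg _, fun i => (Int.fract_lt_one _).le⟩
    have h1 := hM ⟨f, hf, rfl⟩
    have h2 := hlow (fun i => ⌊s i⌋)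
    have h3 : (∑ i, ((⌊s i⌋ : ℤ) : ℝ) • e i) = x - ∑ i, f i • e i := by
      conv_rhs => rw [← e.sum_repr x]
      rw [← Finset.sum_sub_distrib]
      refine Finset.sum_congr rfl fun i _ => ?_
      rw [← sub_smul]
      congr 1
      exact (Int.self_sub_fract (s i)).symm
    rw [h3] at h2
    have h4 : q (∑ i, f i • e i) x = 0 := by
      rw [hqQ, hsym, ← hqQ, hx0]; rfl
    generalize hg : (∑ i, f i • e i) = r at *
    simp only [map_sub, LinearMap.sub_apply, hx0, h4, LinearMap.zero_apply] at h2
    simp only [P, hg] at h1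
    linarith
  have hzero : β ∈ (LinearMap.ker q).dualAnnihilator := by
    rw [Submodule.mem_dualAnnihilator]
    intro x hx
    by_contra hne
    have h := hker (((-(M - d + Θ 0) - 1) / β x) • x) (Submodule.smul_mem _ _ hx)
    rw [map_smul, smul_eq_mul, div_mul_cancel₀ _ hne] at h
    linarith
  rw [← LinearMap.range_dualMap_eq_dualAnnihilator_ker] at hzero
  obtain ⟨φ, hφ⟩ := hzero
  obtain ⟨v, hv⟩ := (Module.evalEquiv ℝ (Fin n → ℝ)).surjective φ
  refine hno ⟨v, c, fun x => ?_⟩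
  have h1 : β x = q x v := by
    rw [← hφ, ← hv]; rfl
  rw [hβ, hqQ, hsym] at h1
  linarith
end
end

section
/- Let Λ be a lattice in ℝ^n, let Q be a positive definite symmetric bilinear form on ℝ^n that is integral with respect to Λ, fix r ∈ ℝ^n, and let B ⊂ ℤ^n be a complete set of representatives of ℤ^n/q(Λ), with l = |B|. Then there exist points q_1, …, q_l ∈ ℝ^n such that every theta function Θ for (Q, Q(·,r)) is affine on some neighborhood of at least one of the points q_1, …, q_l; that is, no theta function for (Q, Q(·,r)) is non-affine near all l points simultaneously. -/
noncomputable section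

lemma dotp_add_r {n : ℕ} (a x y : Fin n → ℝ) : dotp a (x + y) = dotp a x + dotp a y := by
  simp [dotp, mul_add, Finset.sum_add_distrib]

lemma dotp_sub_l {n : ℕ} (a b x : Fin n → ℝ) :
    dotp (fun i => a i - b i) x = dotp a x - dotp b x := by
  simp [dotp, sub_mul, Finset.sum_sub_distrib]

lemma dotp_smul_r {n : ℕ} (a : Fin n → ℝ) (c : ℝ) (x : Fin n → ℝ) :
    dotp a (c • x) = c * dotp a x := by
  simp only [dotp, Pi.smul_apply, smul_eq_mul, Finset.mul_sum]
  exact Finset.sum_congr rfl fun i _ => by ring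

lemma dotp_cont {n : ℕ} (a : Fin n → ℝ) : Continuous (dotp a) := by
  unfold dotp; fun_prop

/-- The linear functional of the pairing. -/
def dotpL {n : ℕ} (a : Fin n → ℝ) : (Fin n → ℝ) →ₗ[ℝ] ℝ where
  toFun := dotp a
  map_add' := dotp_add_r a
  map_smul' c x := by simp [dotp_smul_r]

/-- Two distinct integral subgradients at a point of non-affineness. -/
lemma exists_two_subgrad {n : ℕ} (Θ : (Fin n → ℝ) → ℝ) (hc : ConvexOn ℝ Set.univ Θ)
    (hr : RegularFn Θ) (q : Fin n → ℝ)
    (hna : ¬ ∃ U ∈ nhds q, ∃ (a : Fin n → ℝ) (c : ℝ), ∀ y ∈ U, Θ y = dotp a y + c) :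
    ∃ a a' : Fin n → ℤ, a ≠ a' ∧
      (∀ y, dotp (fun i => (a i : ℝ)) y - Θ y ≤ dotp (fun i => (a i : ℝ)) q - Θ q) ∧
      (∀ y, dotp (fun i => (a' i : ℝ)) y - Θ y ≤ dotp (fun i => (a' i : ℝ)) q - Θ q) := by
  obtain ⟨U, hU, k, a, c, h⟩ := hr q
  have hqU : q ∈ U := mem_of_mem_nhds hU
  set g : Fin (k+1) → (Fin n → ℝ) → ℝ := fun i y => dotp (fun j => (a i j : ℝ)) y + c i with hg
  have hgc : ∀ i, Continuous (g i) := fun i => (dotp_cont _).add continuous_const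
  have hle : ∀ i, ∀ y ∈ U, g i y ≤ Θ y := fun i y hy => by
    rw [h y hy]; exact Finset.le_sup' (fun i => g i y) (Finset.mem_univ i)
  have hex : ∀ y ∈ U, ∃ i, Θ y = g i y := fun y hy => by
    obtain ⟨i, -, hi⟩ := Finset.exists_mem_eq_sup' Finset.univ_nonempty (fun i => g i y)
    exact ⟨i, by rw [h y hy, ← hi]⟩
  obtain ⟨i₀, hi₀⟩ := hex q hqU
  -- active indices are global subgradients
  have hsub : ∀ i, Θ q = g i q →
      ∀ y, dotp (fun j => (a i j : ℝ)) y - Θ y ≤ dotp (fun j => (a i j : ℝ)) q - Θ q := by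
    intro i hi
    have hcv : ConvexOn ℝ Set.univ (fun y => Θ y - dotpL (fun j => (a i j : ℝ)) y) :=
      hc.sub (LinearMap.concaveOn _ convex_univ)
    have hlm : IsLocalMin (fun y => Θ y - dotpL (fun j => (a i j : ℝ)) y) q := by
      filter_upwards [hU] with y hy
      have h1 := hle i y hy
      have h2 : dotpL (fun j => (a i j : ℝ)) y = dotp (fun j => (a i j : ℝ)) y := rfl
      have h3 : dotpL (fun j => (a i j : ℝ)) q = dotp (fun j => (a i j : ℝ)) q := rfl
      simp only [hg] at h1 hi
      rw [h2, h3]; linarith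
    intro y
    have := IsMinOn.of_isLocalMin_of_convex_univ hlm hcv y
    have h2 : dotpL (fun j => (a i j : ℝ)) y = dotp (fun j => (a i j : ℝ)) y := rfl
    have h3 : dotpL (fun j => (a i j : ℝ)) q = dotp (fun j => (a i j : ℝ)) q := rfl
    rw [h2, h3] at this
    linarith
  by_cases hall : ∀ i, Θ q = g i q → a i = a i₀
  · exfalso
    apply hna
    have hev : ∀ᶠ y in nhds q, ∀ i, Θ q ≠ g i q → g i y < g i₀ y := by
      rw [Filter.eventually_all]
      intro i
      by_cases hi : Θ q = g i q
      · exact Filter.Eventually.of_forall fun y hy => absurd hi hy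
      · have : g i q < g i₀ q := by
          rw [← hi₀]; exact lt_of_le_of_ne (hle i q hqU) (Ne.symm hi)
        filter_upwards [(hgc i).continuousAt.eventually_lt (hgc i₀).continuousAt this] with y hy _
        exact hy
    refine ⟨_, Filter.inter_mem hU hev, fun j => (a i₀ j : ℝ), c i₀, ?_⟩
    rintro y ⟨hy, hy'⟩
    obtain ⟨i, hi⟩ := hex y hy
    by_cases hq : Θ q = g i q
    · have h1 := hall i hq
      have h2 : c i = c i₀ := by
        have := hq.symm.trans hi₀
        simp only [hg, h1] at this
        linarith
      rw [hi]; simp only [hg, h1, h2]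
    · have := hy' i hq
      have h3 := hle i₀ y hy
      linarith
  · push Not at hall
    obtain ⟨i, hi, hne⟩ := hall
    exact ⟨a i, a i₀, hne, hsub i hi, hsub i₀ hi₀⟩

/-- Legendre transform values at a translate of a subgradient. -/
lemma legendre_shift {n : ℕ} (Λ : Set (Fin n → ℝ)) (Q : (Fin n → ℝ) → (Fin n → ℝ) → ℝ)
    (hQ : IsSymmBilin Q) (r : Fin n → ℝ) (Θ : (Fin n → ℝ) → ℝ)
    (hqp : QuasiPeriodic Λ Q (fun x => Q x r) Θ) (a b l q : Fin n → ℝ) (hl : l ∈ Λ)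
    (hab : ∀ x, dotp (fun i => a i - b i) x = Q l x)
    (hs : ∀ y, dotp a y - Θ y ≤ dotp a q - Θ q) :
    legendreT Θ b = dotp a q - Θ q - (dotp a l - (1/2) * Q l l - Q l r) := by
  have key : ∀ z, dotp b z - Θ z =
      dotp a (z + l) - Θ (z + l) - (dotp a l - (1/2) * Q l l - Q l r) := by
    intro z
    have h1 := hqp l hl z
    have h2 := hab z
    rw [dotp_sub_l] at h2
    simp only at h1
    rw [h1, dotp_add_r]
    linarith
  apply IsGreatest.csSup_eq
  constructor
  · refine ⟨q - l, ?_⟩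
    rw [key, sub_add_cancel]
  · rintro t ⟨z, rfl⟩
    rw [key]
    have := hs (z + l)
    linarith

/-- `l` difference vectors in the sum-zero hyperplane of `ℝ^l` are dependent. -/
lemma exists_dep {l : ℕ} (hl : 0 < l) (s t : Fin l → Fin l) :
    ∃ w : Fin l → ℝ, w ≠ 0 ∧ ∀ T : Fin l → ℝ, ∑ k, w k * (T (s k) - T (t k)) = 0 := by
  let M : Matrix (Fin l) (Fin l) ℝ := fun k j =>
    (if s k = j then 1 else 0) - (if t k = j then 1 else 0)
  have hM : ∀ (T : Fin l → ℝ) k, (M.mulVec T) k = T (s k) - T (t k) := by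
    intro T k
    simp [Matrix.mulVec, dotProduct, M, sub_mul, Finset.sum_sub_distrib]
  have h1 : ∃ v : Fin l → ℝ, v ≠ 0 ∧ M.mulVec v = 0 := by
    refine ⟨fun _ => 1, ?_, ?_⟩
    · intro h
      have := congrFun h ⟨0, hl⟩
      simp at this
    · ext k; rw [hM]; simp
  have hdet := Matrix.exists_mulVec_eq_zero_iff.mp h1
  obtain ⟨w, hw, hw0⟩ := Matrix.exists_vecMul_eq_zero_iff.mpr hdet
  refine ⟨w, hw, fun T => ?_⟩
  have : w ⬝ᵥ M.mulVec T = 0 := by rw [Matrix.dotProduct_mulVec, hw0]; simp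
  rw [← this]
  simp only [dotProduct, hM]

/-- The complement of a nondegenerate affine hyperplane is open and dense. -/
lemma hyper_open_dense {n l : ℕ} (w : Fin l → ℝ) (hw : w ≠ 0) (e : Fin l → Fin n → ℝ)
    (he : ∀ k, e k ≠ 0) (c : ℝ) :
    IsOpen {q : Fin l → Fin n → ℝ | ∑ k, w k * dotp (e k) (q k) ≠ c} ∧
    Dense {q : Fin l → Fin n → ℝ | ∑ k, w k * dotp (e k) (q k) ≠ c} := by
  let F : (Fin l → Fin n → ℝ) →ₗ[ℝ] ℝ :=
    ∑ k, w k • (dotpL (e k)).comp (LinearMap.proj k)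
  have hF : ∀ q, F q = ∑ k, w k * dotp (e k) (q k) := by
    intro q
    simp only [F, LinearMap.sum_apply, LinearMap.smul_apply, LinearMap.comp_apply,
      LinearMap.proj_apply, smul_eq_mul]
    rfl
  have hcont : Continuous F := F.continuous_of_finiteDimensional
  have hset : {q : Fin l → Fin n → ℝ | ∑ k, w k * dotp (e k) (q k) ≠ c} = F ⁻¹' {c}ᶜ := by
    ext q; simp [hF]
  rw [hset]
  refine ⟨isOpen_compl_singleton.preimage hcont, ?_⟩
  have hne : F ≠ 0 := by
    obtain ⟨k, hk⟩ := Function.ne_iff.mp hw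
    obtain ⟨i, hi⟩ := Function.ne_iff.mp (he k)
    intro h0
    have h1 := hF (Pi.single k (Pi.single i 1))
    rw [h0, Finset.sum_eq_single k] at h1
    · simp [dotp, Pi.single_apply] at h1
      rcases h1 with h1 | h1
      · exact hk h1
      · exact hi h1
    · intro j _ hj
      simp [dotp, Pi.single_apply, hj]
    · simp
  have hsurj : Function.Surjective F := LinearMap.surjective hne
  exact (dense_compl_singleton c).preimage (F.isOpenMap_of_finiteDimensional hsurj)

theorem stmt19 {n : ℕ} (Λ : Set (Fin n → ℝ)) (hΛ : IsLattice Λ)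
    (Q : (Fin n → ℝ) → (Fin n → ℝ) → ℝ) (hQ : IsSymmBilin Q)
    (hpos : ∀ x : Fin n → ℝ, x ≠ 0 → 0 < Q x x) (hint : IntegralWrt Q Λ)
    (r : Fin n → ℝ) (B : Finset (Fin n → ℤ))
    (hB : ∀ m : Fin n → ℤ, ∃! b, b ∈ B ∧
      InQLat Λ Q (fun i => (m i : ℝ) - (b i : ℝ))) :
    ∃ q : Fin B.card → (Fin n → ℝ),
      ∀ Θ : (Fin n → ℝ) → ℝ, IsThetaFn Λ Q (fun x => Q x r) Θ →
        ∃ k : Fin B.card, ∃ U ∈ nhds (q k), ∃ (a : Fin n → ℝ) (c : ℝ),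
          ∀ y ∈ U, Θ y = dotp a y + c := by
  have hB0 : 0 < B.card := by
    obtain ⟨b, ⟨hb, -⟩, -⟩ := hB 0
    exact Finset.card_pos.mpr ⟨b, hb⟩
  let ρ : Fin B.card → Fin n → ℤ := fun j => (B.equivFin.symm j).1
  have hrep : ∀ m : Fin n → ℤ, ∃ j : Fin B.card, ∃ l ∈ Λ, ∀ x,
      dotp (fun i => (m i : ℝ) - (ρ j i : ℝ)) x = Q l x := by
    intro m
    obtain ⟨b, ⟨hb, l, hl, h⟩, -⟩ := hB m
    refine ⟨B.equivFin ⟨b, hb⟩, l, hl, ?_⟩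
    simpa [ρ] using h
  choose β lam hlam hβ using hrep
  let C : (Fin n → ℤ) → ℝ := fun m =>
    dotp (fun i => (m i : ℝ)) (lam m) - (1/2) * Q (lam m) (lam m) - Q (lam m) r
  let D := {d : Fin B.card → (Fin n → ℤ) × (Fin n → ℤ) // ∀ k, (d k).1 ≠ (d k).2}
  have hdep : ∀ d : D, ∃ w : Fin B.card → ℝ, w ≠ 0 ∧ ∀ T : Fin B.card → ℝ,
      ∑ k, w k * (T (β (d.1 k).1) - T (β (d.1 k).2)) = 0 := fun d =>
    exists_dep hB0 (fun k => β (d.1 k).1) (fun k => β (d.1 k).2)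
  choose w hw hwT using hdep
  let e : D → Fin B.card → Fin n → ℝ := fun d k i => ((d.1 k).1 i : ℝ) - ((d.1 k).2 i : ℝ)
  have he : ∀ d k, e d k ≠ 0 := by
    intro d k h
    apply d.2 k
    funext i
    have := congrFun h i
    simp only [e, Pi.zero_apply, sub_eq_zero] at this
    exact_mod_cast this
  let G : D → Set (Fin B.card → Fin n → ℝ) := fun d =>
    {q | ∑ k, w d k * dotp (e d k) (q k) ≠ ∑ k, w d k * (C (d.1 k).1 - C (d.1 k).2)}
  have hG := fun d : D => hyper_open_dense (w d) (hw d) (e d) (he d)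
    (∑ k, w d k * (C (d.1 k).1 - C (d.1 k).2))
  have hdense : Dense (⋂ d, G d) :=
    dense_iInter_of_isOpen (fun d => (hG d).1) (fun d => (hG d).2)
  obtain ⟨q, hq⟩ := hdense.nonempty
  refine ⟨q, fun Θ hΘ => ?_⟩
  obtain ⟨hc, hr, hqp⟩ := hΘ
  by_contra hno
  push Not at hno
  have htwo := fun k => exists_two_subgrad Θ hc hr (q k) (by
    rintro ⟨U, hU, a, c, h⟩
    obtain ⟨y, hy, hne⟩ := hno k U hU a c
    exact hne (h y hy))
  choose a a' hne hs hs' using htwo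
  let d : D := ⟨fun k => (a k, a' k), hne⟩
  refine Set.mem_iInter.mp hq d ?_
  let T : Fin B.card → ℝ := fun j => legendreT Θ (fun i => (ρ j i : ℝ))
  have hT := hwT d T
  have h1 : ∀ k, T (β (a k)) - T (β (a' k)) = dotp (e d k) (q k) - (C (a k) - C (a' k)) := by
    intro k
    have e1 := legendre_shift Λ Q hQ r Θ hqp (fun i => (a k i : ℝ)) (fun i => (ρ (β (a k)) i : ℝ))
      (lam (a k)) (q k) (hlam _) (hβ _) (hs k)
    have e2 := legendre_shift Λ Q hQ r Θ hqp (fun i => (a' k i : ℝ))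
      (fun i => (ρ (β (a' k)) i : ℝ)) (lam (a' k)) (q k) (hlam _) (hβ _) (hs' k)
    have e3 : dotp (e d k) (q k) = dotp (fun i => (a k i : ℝ)) (q k)
        - dotp (fun i => (a' k i : ℝ)) (q k) := dotp_sub_l _ _ _
    simp only [T, C]
    rw [e1, e2, e3]
    ring
  have h2 : ∑ k, w d k * (dotp (e d k) (q k) - (C (a k) - C (a' k))) = 0 := by
    rw [← hT]
    exact Finset.sum_congr rfl fun k _ => by rw [← h1 k]
  simp only [mul_sub (w d _) (dotp _ _), Finset.sum_sub_distrib] at h2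
  exact sub_eq_zero.mp h2
end
end
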